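/- Let G be a connected graph on n vertices containing no triangle (no cycle of length 3), with e edges, and suppose G is not a tree (so e ≥ n). Then Δ_2(G) is homotopy equivalent to a wedge of e - n + 1 spheres of dimension n - 4. -/

import Mathlib

open Finset

/-- The induced subgraph of `G` on the vertex set `S` is disconnected. -/
def IsDisconn {V : Type*} (G : SimpleGraph V) (S : Finset V) : Prop :=
  ¬ (G.induce (S : Set V)).Connected

/-- `σ` is a face of the k-cut complex `Δ_k(G)`: the complement of `σ`
contains a `k`-subset inducing a disconnected subgraph. -/
def IsFace {V : Type*} [Fintype V] [DecidableEq V] (G : SimpleGraph V) (k : ℕ)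
    (σ : Finset V) : Prop :=
  ∃ S : Finset V, S ⊆ σᶜ ∧ S.card = k ∧ IsDisconn G S

/-- `F` is a facet of the k-cut complex `Δ_k(G)`: the complement of `F` is a
disconnected `k`-set. -/
def IsFacet {V : Type*} [Fintype V] [DecidableEq V] (G : SimpleGraph V) (k : ℕ)
    (F : Finset V) : Prop :=
  Fᶜ.card = k ∧ IsDisconn G Fᶜ

/-- A list of the facets of a pure complex is a shelling order. -/
def IsShelling {V : Type*} [DecidableEq V] (l : List (Finset V)) : Prop :=
  ∀ i j : ℕ, i < j → j < l.length →
    ∃ m, m < j ∧ (l.getD i ∅ ∩ l.getD j ∅ ⊆ l.getD m ∅ ∩ l.getD j ∅) ∧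
      (l.getD m ∅ ∩ l.getD j ∅).card + 1 = (l.getD j ∅).card

/-- A complex, given by its facet predicate, is shellable. -/
def Shellable {V : Type*} [DecidableEq V] (Fac : Finset V → Prop) : Prop :=
  ∃ l : List (Finset V), l.Nodup ∧ (∀ F, F ∈ l ↔ Fac F) ∧ IsShelling l

/-- Geometric realization of the simplicial complex with face predicate `K`. -/
noncomputable abbrev Realization {V : Type*} [Fintype V] (K : Finset V → Prop) : Type _ :=
  {f : V → ℝ // (∀ v, 0 ≤ f v) ∧ (∑ v, f v) = 1 ∧ ∃ σ : Finset V, K σ ∧ ∀ v, f v ≠ 0 → v ∈ σ}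

/-- The `d`-dimensional sphere. -/
noncomputable abbrev Sphere (d : ℕ) := Metric.sphere (0 : EuclideanSpace ℝ (Fin (d+1))) 1

/-- Wedge of `N` spheres of dimension `d`, glued at the basepoint `b`. -/
noncomputable abbrev WedgeSpheres (N d : ℕ) (b : Sphere d) : Type :=
  Quot (fun x y : Fin N × Sphere d => x.2 = b ∧ y.2 = b)

/-- If `q` is a quotient map whose only nontrivial fibre is the set `A`, and the identity of `X`
can be deformed, keeping `A` inside itself, to a map that is constant on `A`, then `q` is a
homotopy equivalence. -/
theorem homotopyEquiv_of_isQuotientMap {X Y : Type*} [TopologicalSpace X] [TopologicalSpace Y]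
    (q : C(X, Y)) (hq : Topology.IsQuotientMap q) (A : Set X)
    (hA : ∀ x y, q x = q y → x = y ∨ x ∈ A ∧ y ∈ A) (hqA : ∀ x ∈ A, ∀ y ∈ A, q x = q y)
    (H : C(unitInterval × X, X)) (h0 : ∀ x, H (0, x) = x) (hHA : ∀ t, ∀ x ∈ A, H (t, x) ∈ A)
    (a : X) (h1 : ∀ x ∈ A, H (1, x) = a) :
    Nonempty (ContinuousMap.HomotopyEquiv X Y) := by
  let H1 : C(X, X) := H.comp ⟨fun x => (1, x), by fun_prop⟩
  have hH1 : Function.FactorsThrough H1 q := by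
    intro x y hxy
    rcases hA x y hxy with rfl | ⟨hx, hy⟩
    · rfl
    · exact (h1 x hx).trans (h1 y hy).symm
  let p : C(Y, X) := hq.lift H1 hH1
  have hp : ∀ x, p (q x) = H (1, x) := fun x =>
    congrArg (fun f : C(X, X) => f x) (hq.lift_comp H1 hH1)
  let K : C(X, C(unitInterval, Y)) :=
    ContinuousMap.curry ((q.comp H).comp ⟨Prod.swap, continuous_swap⟩)
  have hK : Function.FactorsThrough K q := by
    intro x y hxy
    rcases hA x y hxy with rfl | ⟨hx, hy⟩
    · rfl
    · ext t
      exact hqA _ (hHA t x hx) _ (hHA t y hy)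
  let L : C(Y, C(unitInterval, Y)) := hq.lift K hK
  have hL : ∀ x t, L (q x) t = q (H (t, x)) := fun x t =>
    congrArg (fun f : C(X, C(unitInterval, Y)) => f x t) (hq.lift_comp K hK)
  refine ⟨⟨q, p, ?_, ?_⟩⟩
  · refine ContinuousMap.Homotopic.symm ⟨⟨H, ?_, ?_⟩⟩
    · intro x; exact h0 x
    · intro x; exact (hp x).symm
  · refine ContinuousMap.Homotopic.symm
      ⟨⟨(ContinuousMap.uncurry L).comp ⟨Prod.swap, continuous_swap⟩, ?_, ?_⟩⟩
    · intro y
      obtain ⟨x, rfl⟩ := hq.surjective y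
      exact (hL x 0).trans (congrArg q (h0 x))
    · intro y
      obtain ⟨x, rfl⟩ := hq.surjective y
      exact (hL x 1).trans (congrArg q (hp x).symm)

/-- A Hausdorff space `X` maps to the one-point compactification of each of its open subspaces,
collapsing the complement to the point at infinity. -/
theorem exists_continuous_collapse {X Z : Type*} [TopologicalSpace X] [TopologicalSpace Z]
    [T2Space X] (j : Z → X) (hj : Topology.IsOpenEmbedding j) :
    ∃ c : C(X, OnePoint Z), (∀ z, c (j z) = z) ∧ ∀ x ∉ Set.range j, c x = OnePoint.infty := by
  classical
  let c : X → OnePoint Z := fun x => if h : x ∈ Set.range j then (h.choose : Z) else OnePoint.infty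
  have hc1 : ∀ z, c (j z) = z := by
    intro z
    have h : j z ∈ Set.range j := ⟨z, rfl⟩
    simp only [c, dif_pos h]
    exact congrArg _ (hj.injective h.choose_spec)
  have hc2 : ∀ x ∉ Set.range j, c x = OnePoint.infty := fun x hx => dif_neg hx
  refine ⟨⟨c, ⟨fun s hs => ?_⟩⟩, hc1, hc2⟩
  by_cases hi : OnePoint.infty ∈ s
  · have hK := ((OnePoint.isOpen_iff_of_mem hi).1 hs).2
    have : c ⁻¹' s = (j '' ((fun z : Z => (z : OnePoint Z)) ⁻¹' s)ᶜ)ᶜ := by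
      ext x
      by_cases hx : x ∈ Set.range j
      · obtain ⟨z, rfl⟩ := hx
        simp [hc1, hj.injective.eq_iff]
      · have : ∀ z, j z ≠ x := fun z hz => hx ⟨z, hz⟩
        simp [hc2 x hx, hi, this]
    rw [this]
    exact (hK.image hj.continuous).isClosed.isOpen_compl
  · have hK := (OnePoint.isOpen_iff_of_notMem hi).1 hs
    have : c ⁻¹' s = j '' ((fun z : Z => (z : OnePoint Z)) ⁻¹' s) := by
      ext x
      by_cases hx : x ∈ Set.range j
      · obtain ⟨z, rfl⟩ := hx
        simp [hc1, hj.injective.eq_iff]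
      · have : ∀ z, j z ≠ x := fun z hz => hx ⟨z, hz⟩
        simp [hc2 x hx, hi, this]
    rw [this]
    exact hj.isOpenMap _ hK

/-- A compact Hausdorff space that deforms so as to contract the complement of an open subspace is
homotopy equivalent to the one-point compactification of that subspace. -/
theorem homotopyEquiv_onePoint {X Z : Type*} [TopologicalSpace X] [TopologicalSpace Z]
    [T2Space X] [CompactSpace X] (j : Z → X) (hj : Topology.IsOpenEmbedding j)
    (H : C(unitInterval × X, X)) (h0 : ∀ x, H (0, x) = x)
    (hHA : ∀ t, ∀ x ∉ Set.range j, H (t, x) ∉ Set.range j)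
    (a : X) (ha : a ∉ Set.range j) (h1 : ∀ x ∉ Set.range j, H (1, x) = a) :
    Nonempty (ContinuousMap.HomotopyEquiv X (OnePoint Z)) := by
  have : T2Space Z := hj.toIsEmbedding.t2Space
  have : LocallyCompactSpace Z := hj.locallyCompactSpace
  obtain ⟨c, hc1, hc2⟩ := exists_continuous_collapse j hj
  have hsurj : Function.Surjective c := by
    intro y
    induction y using OnePoint.rec with
    | infty => exact ⟨a, hc2 a ha⟩
    | coe z => exact ⟨j z, hc1 z⟩
  refine homotopyEquiv_of_isQuotientMap c
    (c.continuous.isClosedMap.isQuotientMap c.continuous hsurj) (Set.range j)ᶜ ?_ ?_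
    H h0 hHA a h1
  · intro x y hxy
    by_cases hx : x ∈ Set.range j <;> by_cases hy : y ∈ Set.range j
    · obtain ⟨z, rfl⟩ := hx
      obtain ⟨w, rfl⟩ := hy
      rw [hc1, hc1, OnePoint.coe_eq_coe] at hxy
      exact Or.inl (congrArg j hxy)
    · obtain ⟨z, rfl⟩ := hx
      rw [hc1, hc2 y hy] at hxy
      exact absurd hxy (OnePoint.coe_ne_infty z)
    · obtain ⟨z, rfl⟩ := hy
      rw [hc1, hc2 x hx] at hxy
      exact absurd hxy.symm (OnePoint.coe_ne_infty z)
    · exact Or.inr ⟨hx, hy⟩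
  · intro x hx y hy
    rw [hc2 x hx, hc2 y hy]

/-- A nonempty wedge of spheres is the one-point compactification of a disjoint union of copies of
Euclidean space. -/
theorem exists_onePoint_homeomorph_wedgeSpheres (N d : ℕ) (hN : 0 < N) :
    ∃ b : Sphere d, Nonempty (OnePoint (Fin N × (Fin d → ℝ)) ≃ₜ WedgeSpheres N d b) := by
  let e : OnePoint (Fin d → ℝ) ≃ₜ Sphere d := onePointEquivSphereOfFinrankEq (by simp)
  let b : Sphere d := e OnePoint.infty
  let s : (Fin d → ℝ) → Sphere d := fun y => e y
  have hs : Topology.IsOpenEmbedding s := e.isOpenEmbedding.comp OnePoint.isOpenEmbedding_coe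
  have hsb : ∀ y, s y ≠ b := fun y h => OnePoint.coe_ne_infty y (e.injective h)
  have hsr : ∀ x, x ≠ b → ∃ y, s y = x := by
    intro x hx
    obtain ⟨y, rfl⟩ := e.surjective x
    induction y using OnePoint.rec with
    | infty => exact absurd rfl hx
    | coe z => exact ⟨z, rfl⟩
  let mk : Fin N × Sphere d → WedgeSpheres N d b := Quot.mk _
  have hmk : Continuous mk := continuous_quot_mk
  let ι : WedgeSpheres N d b → Fin N → Sphere d :=
    Quot.lift (fun p => Function.update (fun _ => b) p.1 p.2) (by
      rintro ⟨i, x⟩ ⟨k, y⟩ ⟨rfl, h⟩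
      simp only at h
      subst h
      simp)
  have hι : Continuous ι := by
    refine continuous_quot_lift _ ?_
    refine continuous_prod_of_discrete_left.2 fun i => ?_
    exact continuous_const.update i continuous_id
  have hιinj : Function.Injective ι := by
    rintro ⟨i, x⟩ ⟨k, y⟩ h
    have h' : Function.update (fun _ => b) i x = Function.update (fun _ => b) k y := h
    by_cases hik : i = k
    · subst hik
      rw [Function.update_injective _ i h']
    · have hx := congrFun h' i
      have hy := congrFun h' k
      rw [Function.update_self, Function.update_of_ne hik] at hx
      rw [Function.update_self, Function.update_of_ne (Ne.symm hik)] at hy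
      exact Quot.sound ⟨hx, hy.symm⟩
  have : T2Space (WedgeSpheres N d b) := T2Space.of_injective_continuous hιinj hι
  let f : Fin N × (Fin d → ℝ) → WedgeSpheres N d b := fun p => mk (p.1, s p.2)
  have hmkf : ∀ i x k y, mk (i, x) = f (k, y) → i = k ∧ x = s y := by
    intro i x k y h
    have h' : Function.update (fun _ => b) i x = Function.update (fun _ => b) k (s y) :=
      congrArg ι h
    by_cases hik : i = k
    · subst hik
      exact ⟨rfl, Function.update_injective _ i h'⟩
    · have hy := congrFun h' k
      rw [Function.update_self, Function.update_of_ne (Ne.symm hik)] at hy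
      exact absurd hy.symm (hsb y)
  have hf : Topology.IsOpenEmbedding f := by
    refine .of_continuous_injective_isOpenMap ?_ ?_ ?_
    · exact hmk.comp (continuous_fst.prodMk (hs.continuous.comp continuous_snd))
    · rintro ⟨i, x⟩ ⟨k, y⟩ h
      obtain ⟨rfl, h'⟩ := hmkf _ _ _ _ h
      exact congrArg (Prod.mk i) (hs.injective h')
    · intro U hU
      have hpre : mk ⁻¹' (f '' U) = Prod.map id s '' U := by
        ext ⟨i, x⟩
        constructor
        · rintro ⟨⟨k, y⟩, hU, h⟩
          obtain ⟨rfl, rfl⟩ := hmkf _ _ _ _ h.symm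
          exact ⟨_, hU, rfl⟩
        · rintro ⟨⟨k, y⟩, hU, h⟩
          exact ⟨_, hU, congrArg mk h⟩
      rw [← (isQuotientMap_quot_mk (X := Fin N × Sphere d)).isOpen_preimage]
      change IsOpen (mk ⁻¹' (f '' U))
      rw [hpre]
      exact (Topology.IsOpenEmbedding.id.prodMap hs).isOpenMap _ hU
  refine ⟨b, ⟨OnePoint.equivOfIsEmbeddingOfRangeEq (mk (⟨0, hN⟩, b)) f hf.toIsEmbedding ?_⟩⟩
  ext w
  obtain ⟨⟨i, x⟩, rfl⟩ := Quot.exists_rep w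
  change (∃ p, f p = mk (i, x)) ↔ mk (i, x) ≠ _
  constructor
  · rintro ⟨⟨k, y⟩, h⟩ h'
    exact hsb y (hmkf _ _ _ _ (h.trans h').symm).2.symm
  · intro h
    have hx : x ≠ b := by
      rintro rfl
      exact h (Quot.sound ⟨rfl, rfl⟩)
    obtain ⟨y, rfl⟩ := hsr x hx
    exact ⟨(i, y), rfl⟩

theorem Realization.support_mem {V : Type*} [Fintype V] {K : Finset V → Prop}
    (hK : ∀ σ ρ, K σ → ρ ⊆ σ → K ρ) (x : Realization K) : K {v | x.1 v ≠ 0} := by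
  obtain ⟨σ, hσ, h⟩ := x.2.2.2
  exact hK σ _ hσ fun v hv => h v (by simpa using hv)

theorem Realization.eq_zero_of_notMem {V : Type*} [Fintype V] {K : Finset V → Prop}
    (x : Realization K) {ρ : Finset V} (hρ : ({v | x.1 v ≠ 0} : Finset V) = ρ) {v : V}
    (hv : v ∉ ρ) : x.1 v = 0 := by
  by_contra h
  exact hv (hρ ▸ by simpa using h)

theorem Realization.subset_support {V : Type*} [Fintype V] {K : Finset V → Prop}
    (x : Realization K) {σ : Finset V} (hσ : σ.Nonempty) (hx : 0 < σ.inf' hσ x.1) :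
    σ ⊆ ({v | x.1 v ≠ 0} : Finset V) := by
  intro v hv
  simpa using ((Finset.lt_inf'_iff hσ).1 hx v hv).ne'

theorem Realization.inf'_nonneg {V : Type*} [Fintype V] {K : Finset V → Prop}
    (x : Realization K) {σ : Finset V} (hσ : σ.Nonempty) : 0 ≤ σ.inf' hσ x.1 :=
  Finset.le_inf' _ _ fun v _ => x.2.1 v

theorem Realization.continuous_inf' {V : Type*} [Fintype V] (K : Finset V → Prop)
    {σ : Finset V} (hσ : σ.Nonempty) : Continuous fun x : Realization K => σ.inf' hσ x.1 :=
  Continuous.finset_inf'_apply hσ fun v _ => (continuous_apply v).comp continuous_subtype_val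

instance Realization.compactSpace {V : Type*} [Fintype V] (K : Finset V → Prop) :
    CompactSpace (Realization K) := by
  suffices IsCompact {f : V → ℝ | (∀ v, 0 ≤ f v) ∧ (∑ v, f v) = 1 ∧
      ∃ σ : Finset V, K σ ∧ ∀ v, f v ≠ 0 → v ∈ σ} from isCompact_iff_compactSpace.1 this
  refine (isCompact_univ_pi (X := fun _ : V => ℝ) (s := fun _ => Set.Icc 0 1)
    fun _ => isCompact_Icc).of_isClosed_subset ?_ ?_
  · have : {f : V → ℝ | (∀ v, 0 ≤ f v) ∧ (∑ v, f v) = 1 ∧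
        ∃ σ : Finset V, K σ ∧ ∀ v, f v ≠ 0 → v ∈ σ} =
        (⋂ v, {f : V → ℝ | 0 ≤ f v}) ∩ ({f | ∑ v, f v = 1} ∩
          ⋃ σ : {σ : Finset V // K σ}, ⋂ v, ⋂ _ : v ∉ σ.1, {f : V → ℝ | f v = 0}) := by
      ext f
      simp only [Set.mem_ofPred_eq, Set.mem_inter_iff, Set.mem_iInter, Set.mem_iUnion,
        Subtype.exists, exists_prop]
      refine and_congr_right fun _ => and_congr_right fun _ => exists_congr fun σ =>
        and_congr_right fun _ => forall_congr' fun v => ⟨fun h hv => ?_, fun h hv => ?_⟩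
      · by_contra h'
        exact hv (h h')
      · by_contra h'
        exact hv (h h')
    rw [this]
    refine (isClosed_iInter fun v => isClosed_le continuous_const (continuous_apply v)).inter
      ((isClosed_eq (by fun_prop) continuous_const).inter
        (isClosed_iUnion_of_finite fun σ => isClosed_iInter fun v => isClosed_iInter fun _ =>
          isClosed_eq (continuous_apply v) continuous_const))
  · rintro f ⟨h0, h1, -⟩ v -
    exact ⟨h0 v, h1 ▸ Finset.single_le_sum (fun w _ => h0 w) (Finset.mem_univ v)⟩

/-- Removing a facet `insert p τ` together with a free face `τ` does not change the homotopy type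
of a simplicial complex. -/
theorem homotopyEquiv_collapse {V : Type*} [Fintype V] [DecidableEq V] (K : Finset V → Prop)
    (hK : ∀ σ ρ, K σ → ρ ⊆ σ → K ρ) (τ : Finset V) (hτ : τ.Nonempty) (p : V) (hp : p ∉ τ)
    (hτp : K (insert p τ)) (hfree : ∀ ρ, K ρ → τ ⊆ ρ → ρ = τ ∨ ρ = insert p τ) :
    Nonempty (ContinuousMap.HomotopyEquiv (Realization K)
      (Realization fun ρ => K ρ ∧ ρ ≠ τ ∧ ρ ≠ insert p τ)) := by
  set K' : Finset V → Prop := fun ρ => K ρ ∧ ρ ≠ τ ∧ ρ ≠ insert p τ with hK'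
  let m : Realization K → ℝ := fun x => τ.inf' hτ x.1
  have hm : Continuous m := Realization.continuous_inf' K hτ
  have hm0 : ∀ x, 0 ≤ m x := fun x => x.inf'_nonneg hτ
  have hmle : ∀ x, ∀ v ∈ τ, m x ≤ x.1 v := fun x v hv => Finset.inf'_le _ hv
  let h : ℝ → Realization K → V → ℝ := fun s x v =>
    x.1 v - s * m x * (if v ∈ τ then 1 else 0) + s * m x * τ.card * (if v = p then 1 else 0)
  have hzero : ∀ s x, m x = 0 → h s x = x.1 := by
    intro s x hx
    funext v
    simp [h, hx]
  have hcont : Continuous fun q : unitInterval × Realization K => h q.1 q.2 := by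
    refine continuous_pi fun v => ?_
    have h1 : Continuous fun q : unitInterval × Realization K => q.2.1 v :=
      (continuous_apply v).comp (continuous_subtype_val.comp continuous_snd)
    have h2 : Continuous fun q : unitInterval × Realization K => m q.2 := hm.comp continuous_snd
    simp only [h]
    fun_prop
  have hnn : ∀ s ∈ unitInterval, ∀ x v, 0 ≤ h s x v := by
    intro s hs x v
    have h1 : 0 ≤ s * m x * τ.card * (if v = p then 1 else 0 : ℝ) := by
      have := hs.1
      have := hm0 x
      split_ifs <;> positivity
    have h2 : s * m x * (if v ∈ τ then 1 else 0 : ℝ) ≤ x.1 v := by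
      split_ifs with hv
      · nlinarith [hmle x v hv, hm0 x, hs.1, hs.2]
      · simpa using x.2.1 v
    simp only [h]
    linarith
  have hsum : ∀ s x, ∑ v, h s x v = 1 := by
    intro s x
    simp only [h, Finset.sum_add_distrib, Finset.sum_sub_distrib, ← Finset.mul_sum, x.2.2.1]
    simp
  have hsupp : ∀ x, m x ≠ 0 → ∀ s v, h s x v ≠ 0 → v ∈ insert p τ := by
    intro x hx s v hv
    by_contra hv'
    obtain ⟨hvp, hvτ⟩ := not_or.1 (Finset.mem_insert.not.1 hv')
    have hsub := x.subset_support hτ (lt_of_le_of_ne (hm0 x) (Ne.symm hx))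
    have hx0 : x.1 v = 0 := by
      rcases hfree _ (x.support_mem hK) hsub with h | h
      · exact x.eq_zero_of_notMem h hvτ
      · exact x.eq_zero_of_notMem h hv'
    simp [h, hvp, hvτ, hx0] at hv
  have hface : ∀ s x, ∃ σ, K σ ∧ ∀ v, h s x v ≠ 0 → v ∈ σ := by
    intro s x
    by_cases hx : m x = 0
    · rw [hzero s x hx]
      exact x.2.2.2
    · exact ⟨_, hτp, hsupp x hx s⟩
  have hsmall : ∀ σ, K σ → ∀ v ∈ τ, v ∉ σ → K' σ := by
    intro σ hσ v hv hvσ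
    refine ⟨hσ, ?_, ?_⟩ <;> rintro rfl <;> simp [hv] at hvσ
  have hface' : ∀ x, ∃ σ, K' σ ∧ ∀ v, h 1 x v ≠ 0 → v ∈ σ := by
    intro x
    obtain ⟨v, hv, hvm⟩ := Finset.exists_mem_eq_inf' hτ x.1
    by_cases hx : m x = 0
    · rw [hzero 1 x hx]
      refine ⟨_, hsmall _ (x.support_mem hK) v hv ?_, fun w hw => by simpa using hw⟩
      have : x.1 v = 0 := hvm ▸ hx
      simp [this]
    · refine ⟨(insert p τ).erase v, hsmall _ (hK _ _ hτp (Finset.erase_subset _ _)) v hv (by simp),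
        fun w hw => Finset.mem_erase.2 ⟨?_, hsupp x hx 1 w hw⟩⟩
      rintro rfl
      have hwp : w ≠ p := by
        rintro rfl
        exact hp hv
      have hm' : m x = x.1 w := hvm
      simp [h, hv, hwp, hm'] at hw
  have hm' : ∀ x, (∃ σ, K' σ ∧ ∀ v, x.1 v ≠ 0 → v ∈ σ) → m x = 0 := by
    rintro x ⟨σ, ⟨hσ, h1, h2⟩, hx⟩
    by_contra hne
    have hsub := x.subset_support hτ (lt_of_le_of_ne (hm0 x) (Ne.symm hne))
    rcases hfree σ hσ (hsub.trans fun v hv => hx v (by simpa using hv)) with h | h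
    · exact h1 h
    · exact h2 h
  let F : C(Realization K, Realization K') :=
    ⟨fun x => ⟨h 1 x, hnn 1 unitInterval.one_mem x, hsum 1 x, hface' x⟩,
      (hcont.comp (continuous_const (y := (1 : unitInterval)).prodMk continuous_id)).subtype_mk _⟩
  let I : C(Realization K', Realization K) :=
    ⟨fun x => ⟨x.1, x.2.1, x.2.2.1, x.2.2.2.imp fun σ hσ => ⟨hσ.1.1, hσ.2⟩⟩,
      continuous_subtype_val.subtype_mk _⟩
  refine ⟨⟨F, I, ?_, ?_⟩⟩
  · refine ContinuousMap.Homotopic.symm ⟨⟨⟨fun q => ⟨h q.1 q.2, hnn _ q.1.2 _, hsum _ _,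
      hface _ _⟩, hcont.subtype_mk _⟩, ?_, ?_⟩⟩
    · intro x
      refine Subtype.ext (funext fun v => ?_)
      simp [h]
    · intro x
      rfl
  · have : F.comp I = ContinuousMap.id _ :=
      ContinuousMap.ext fun x => Subtype.ext (hzero 1 (I x) (hm' (I x) x.2.2.2))
    rw [this]

/-- The relative interior of a `d`-dimensional facet is open and homeomorphic to Euclidean
space. -/
theorem exists_isOpenEmbedding_of_facet {V : Type*} [Fintype V] {K : Finset V → Prop}
    (hK : ∀ σ ρ, K σ → ρ ⊆ σ → K ρ) (σ : Finset V) (hσ : K σ)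
    (hmax : ∀ ρ, K ρ → σ ⊆ ρ → ρ = σ) (d : ℕ) (hd : σ.card = d + 1) :
    ∃ j : (Fin d → ℝ) → Realization K, Topology.IsOpenEmbedding j ∧
      Set.range j = {x | ∀ v ∈ σ, 0 < x.1 v} := by
  classical
  let e : σ ≃ Fin (d + 1) := σ.equivFinOfCardEq hd
  let Y : (Fin d → ℝ) → Fin (d + 1) → ℝ := fun y => Fin.cons 0 y
  have hY : Continuous Y := by
    refine continuous_pi fun k => ?_
    refine Fin.cases ?_ (fun k => ?_) k
    · simpa [Y] using continuous_const
    · simpa [Y] using continuous_apply k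
  let S : (Fin d → ℝ) → ℝ := fun y => ∑ k, Real.exp (Y y k)
  have hS : ∀ y, 0 < S y := fun y => Finset.sum_pos (fun k _ => Real.exp_pos _) ⟨0, by simp⟩
  have hScont : Continuous S := continuous_finsetSum _ fun k _ =>
    Real.continuous_exp.comp ((continuous_apply k).comp hY)
  let f : (Fin d → ℝ) → V → ℝ := fun y v =>
    if h : v ∈ σ then Real.exp (Y y (e ⟨v, h⟩)) / S y else 0
  have hfσ : ∀ y (v : σ), f y v = Real.exp (Y y (e v)) / S y := fun y v => dif_pos v.2
  have hsumσ : ∀ g : V → ℝ, (∀ v ∉ σ, g v = 0) → ∑ v, g v = ∑ v : σ, g v := by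
    intro g hg
    rw [Finset.sum_coe_sort σ g]
    exact (Finset.sum_subset (Finset.subset_univ σ) fun v _ hv => hg v hv).symm
  let j : (Fin d → ℝ) → Realization K := fun y => ⟨f y, by
      intro v
      simp only [f]
      have := (hS y).le
      split_ifs <;> positivity, by
      rw [hsumσ (f y) fun v hv => dif_neg hv]
      simp only [hfσ, ← Finset.sum_div]
      rw [div_eq_one_iff_eq (hS y).ne']
      exact e.sum_comp fun k => Real.exp (Y y k), σ, hσ, by
      intro v hv
      by_contra h
      exact hv (dif_neg h)⟩
  have hj : Continuous j := by
    refine Continuous.subtype_mk (continuous_pi fun v => ?_) _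
    by_cases hv : v ∈ σ
    · simp only [f, dif_pos hv]
      exact (Real.continuous_exp.comp ((continuous_apply _).comp hY)).div hScont
        fun y => (hS y).ne'
    · simp only [f, dif_neg hv]
      exact continuous_const
  let U : Set (Realization K) := {x | ∀ v ∈ σ, 0 < x.1 v}
  have hU : IsOpen U := by
    have : U = ⋂ v ∈ σ, {x : Realization K | 0 < x.1 v} := by
      ext x
      simp [U]
    rw [this]
    exact isOpen_biInter_finset fun v _ =>
      isOpen_lt continuous_const ((continuous_apply v).comp continuous_subtype_val)
  have hjU : ∀ y, j y ∈ U := fun y v hv => by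
    rw [show (j y).1 v = _ from hfσ y ⟨v, hv⟩]
    exact div_pos (Real.exp_pos _) (hS y)
  let g : Realization K → Fin d → ℝ := fun x k =>
    Real.log (x.1 (e.symm k.succ)) - Real.log (x.1 (e.symm 0))
  have hg : ContinuousOn g U := by
    refine continuousOn_pi.2 fun k => ?_
    have : ∀ v : σ, ContinuousOn (fun x : Realization K => Real.log (x.1 v)) U := fun v =>
      ContinuousOn.log ((continuous_apply v.1).comp continuous_subtype_val).continuousOn
        fun x hx => (hx v v.2).ne'
    exact (this _).sub (this _)
  have hgj : ∀ y, g (j y) = y := by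
    intro y
    funext k
    change Real.log (f y _) - Real.log (f y _) = _
    rw [hfσ, hfσ, Real.log_div (Real.exp_ne_zero _) (hS y).ne',
      Real.log_div (Real.exp_ne_zero _) (hS y).ne']
    simp [Y]
  have hjg : ∀ x ∈ U, j (g x) = x := by
    intro x hx
    have hxσ : ∀ v ∉ σ, x.1 v = 0 := fun v hv =>
      x.eq_zero_of_notMem (hmax _ (x.support_mem hK) fun w hw => by
        simpa using (hx w hw).ne') hv
    have hx0 : 0 < x.1 (e.symm 0) := hx _ (e.symm 0).2
    have hexp : ∀ k, Real.exp (Y (g x) k) = x.1 (e.symm k) / x.1 (e.symm 0) := by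
      intro k
      refine Fin.cases ?_ (fun k => ?_) k
      · simp [Y, hx0.ne']
      · simp only [Y, Fin.cons_succ, g]
        rw [Real.exp_sub, Real.exp_log (hx _ (e.symm k.succ).2), Real.exp_log hx0]
    have hSx : S (g x) = 1 / x.1 (e.symm 0) := by
      simp only [S, hexp, ← Finset.sum_div]
      congr 1
      rw [e.symm.sum_comp fun v : σ => x.1 v, ← hsumσ x.1 hxσ]
      exact x.2.2.1
    refine Subtype.ext (funext fun v => ?_)
    change f (g x) v = _
    by_cases hv : v ∈ σ
    · rw [hfσ (g x) ⟨v, hv⟩, hexp, hSx, e.symm_apply_apply]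
      field_simp
    · rw [hxσ v hv]
      exact dif_neg hv
  let P : OpenPartialHomeomorph (Fin d → ℝ) (Realization K) :=
    { toFun := j, invFun := g, source := Set.univ, target := U
      map_source' := fun y _ => hjU y
      map_target' := fun _ _ => Set.mem_univ _
      left_inv' := fun y _ => hgj y
      right_inv' := hjg
      open_source := isOpen_univ
      open_target := hU
      continuousOn_toFun := hj.continuousOn
      continuousOn_invFun := hg }
  refine ⟨j, P.isOpenEmbedding rfl, Set.Subset.antisymm ?_ fun x hx => ⟨g x, hjg x hx⟩⟩
  rintro _ ⟨y, rfl⟩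
  exact hjU y

/-- A simplicial complex all of whose faces lie in the star of a vertex `r`, except for `N > 0`
facets of dimension `d` avoiding `r`, is homotopy equivalent to a wedge of `N` spheres of
dimension `d`. -/
theorem homotopyEquiv_wedgeSpheres {V : Type*} [Fintype V] [DecidableEq V] (K : Finset V → Prop)
    (hK : ∀ σ ρ, K σ → ρ ⊆ σ → K ρ) (r : V) (hr : K {r}) (N d : ℕ) (hN : 0 < N)
    (σ : Fin N → Finset V) (hσinj : Function.Injective σ) (hcard : ∀ i, (σ i).card = d + 1)
    (hσ : ∀ i, K (σ i)) (hrσ : ∀ i, ¬ K (insert r (σ i)))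
    (hcov : ∀ τ, K τ → K (insert r τ) ∨ ∃ i, τ = σ i) :
    ∃ b : Sphere d,
      Nonempty (ContinuousMap.HomotopyEquiv (Realization K) (WedgeSpheres N d b)) := by
  have hmax : ∀ i ρ, K ρ → σ i ⊆ ρ → ρ = σ i := by
    intro i ρ hρ hsub
    rcases hcov ρ hρ with h | ⟨k, rfl⟩
    · exact absurd (hK _ _ h (Finset.insert_subset_insert r hsub)) (hrσ i)
    · exact (Finset.eq_of_subset_of_card_le hsub (by rw [hcard, hcard])).symm
  have hr' : ∀ i, r ∉ σ i := fun i h => hrσ i (by rw [Finset.insert_eq_of_mem h]; exact hσ i)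
  have hne : ∀ i, (σ i).Nonempty := fun i => Finset.card_pos.1 (by rw [hcard]; omega)
  choose j hj hjr using fun i => exists_isOpenEmbedding_of_facet hK (σ i) (hσ i) (hmax i) d
    (hcard i)
  have hsuppσ : ∀ i (x : Realization K), (∀ v ∈ σ i, 0 < x.1 v) →
      ({v | x.1 v ≠ 0} : Finset V) = σ i := fun i x hx =>
    hmax i _ (x.support_mem hK) fun v hv => by simpa using (hx v hv).ne'
  let J : Fin N × (Fin d → ℝ) → Realization K := fun q => j q.1 q.2
  have hJr : ∀ x, x ∈ Set.range J ↔ ∃ i, ∀ v ∈ σ i, 0 < x.1 v := by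
    intro x
    have : ∀ i, x ∈ Set.range (j i) ↔ ∀ v ∈ σ i, 0 < x.1 v := fun i => by rw [hjr i]; rfl
    simp only [← this]
    exact ⟨fun ⟨⟨i, y⟩, h⟩ => ⟨i, y, h⟩, fun ⟨i, y, h⟩ => ⟨⟨i, y⟩, h⟩⟩
  have hJ : Topology.IsOpenEmbedding J := by
    refine .of_continuous_injective_isOpenMap ?_ ?_ ?_
    · exact continuous_prod_of_discrete_left.2 fun i => (hj i).continuous
    · rintro ⟨i, y⟩ ⟨k, z⟩ (h : j i y = j k z)
      have hi : j i y ∈ Set.range (j i) := ⟨y, rfl⟩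
      have hk : j i y ∈ Set.range (j k) := ⟨z, h.symm⟩
      rw [hjr] at hi hk
      obtain rfl := hσinj ((hsuppσ i _ hi).symm.trans (hsuppσ k _ hk))
      exact congrArg (Prod.mk i) ((hj i).injective h)
    · exact isOpenMap_prod_of_discrete_left.2 fun i => (hj i).isOpenMap
  let m : Fin N → Realization K → ℝ := fun i x => (σ i).inf' (hne i) x.1
  have hm : ∀ i, Continuous (m i) := fun i => Realization.continuous_inf' K (hne i)
  have hm0 : ∀ i x, 0 ≤ m i x := fun i x => x.inf'_nonneg (hne i)
  have hmpos : ∀ i x, 0 < m i x → ∀ v ∈ σ i, 0 < x.1 v := fun i x h =>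
    (Finset.lt_inf'_iff (hne i)).1 h
  let κ : ℝ := 1 / (Fintype.card V + 1)
  have hκ : 0 < κ := by positivity
  let θ : Realization K → ℝ := fun x => ∑ i, m i x
  have hθ0 : ∀ x, 0 ≤ θ x := fun x => Finset.sum_nonneg fun i _ => hm0 i x
  let z : ℝ → Realization K → V → ℝ := fun s x v =>
    if v = r then x.1 r + max (s * κ - θ x) 0
    else ((1 - s) + θ x) *
      (x.1 v - ∑ i, (if v ∈ σ i then 1 else 0) * min (m i x) (s * κ))
  have hzr : ∀ s x, z s x r = x.1 r + max (s * κ - θ x) 0 := fun s x => if_pos rfl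
  have hzv : ∀ s x v, v ≠ r → z s x v = ((1 - s) + θ x) *
      (x.1 v - ∑ i, (if v ∈ σ i then 1 else 0) * min (m i x) (s * κ)) :=
    fun s x v hv => if_neg hv
  -- points outside the open cells
  have hstar_m : ∀ x, x ∉ Set.range J → ∀ i, m i x = 0 := by
    intro x hx i
    by_contra h
    exact hx ((hJr x).2 ⟨i, hmpos i x (lt_of_le_of_ne (hm0 i x) (Ne.symm h))⟩)
  have hstar_θ : ∀ x, x ∉ Set.range J → θ x = 0 := fun x hx =>
    Finset.sum_eq_zero fun i _ => hstar_m x hx i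
  have hstar_z : ∀ s ∈ unitInterval, ∀ x, x ∉ Set.range J → ∀ v, v ≠ r →
      z s x v = (1 - s) * x.1 v := by
    intro s hs x hx v hv
    have : 0 ≤ s * κ := mul_nonneg hs.1 hκ.le
    rw [hzv s x v hv, hstar_θ x hx]
    simp [hstar_m x hx, this]
  -- points inside an open cell
  have hcell_m : ∀ (x : Realization K) i, (∀ v ∈ σ i, 0 < x.1 v) → ∀ k ≠ i, m k x = 0 := by
    intro x i hx k hk
    by_contra h
    have := hmpos k x (lt_of_le_of_ne (hm0 k x) (Ne.symm h))
    exact hk (hσinj ((hsuppσ k x this).symm.trans (hsuppσ i x hx)))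
  have hcell_θ : ∀ x i, (∀ v ∈ σ i, 0 < x.1 v) → θ x = m i x := fun x i hx =>
    Finset.sum_eq_single i (fun k _ hk => hcell_m x i hx k hk) (by simp)
  have hcell_z : ∀ s ∈ unitInterval, ∀ x i, (∀ v ∈ σ i, 0 < x.1 v) → ∀ v, v ≠ r → z s x v =
      ((1 - s) + m i x) * (x.1 v - (if v ∈ σ i then 1 else 0) * min (m i x) (s * κ)) := by
    intro s hs x i hx v hv
    have : 0 ≤ s * κ := mul_nonneg hs.1 hκ.le
    rw [hzv s x v hv, hcell_θ x i hx, Finset.sum_eq_single i]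
    · intro k _ hk
      simp [hcell_m x i hx k hk, this]
    · simp
  have hcell_r : ∀ (x : Realization K) i, (∀ v ∈ σ i, 0 < x.1 v) → x.1 r = 0 := fun x i hx =>
    x.eq_zero_of_notMem (hsuppσ i x hx) (hr' i)
  have hznn : ∀ s ∈ unitInterval, ∀ x v, 0 ≤ z s x v := by
    intro s hs x v
    by_cases hv : v = r
    · subst hv
      rw [hzr]
      exact add_nonneg (x.2.1 v) (le_max_right _ _)
    by_cases hx : x ∈ Set.range J
    · obtain ⟨i, hi⟩ := (hJr x).1 hx
      rw [hcell_z s hs x i hi v hv]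
      refine mul_nonneg (add_nonneg (sub_nonneg.2 hs.2) (hm0 i x)) (sub_nonneg.2 ?_)
      split_ifs with hvi
      · rw [one_mul]
        exact (min_le_left _ _).trans (Finset.inf'_le _ hvi)
      · simpa using x.2.1 v
    · rw [hstar_z s hs x hx v hv]
      exact mul_nonneg (sub_nonneg.2 hs.2) (x.2.1 v)
  have hzpos : ∀ s ∈ unitInterval, ∀ x, ∃ v, 0 < z s x v := by
    intro s hs x
    by_cases hsθ : θ x < s * κ
    · refine ⟨r, ?_⟩
      rw [hzr]
      exact add_pos_of_nonneg_of_pos (x.2.1 r) (lt_max_of_lt_left (sub_pos.2 hsθ))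
    rw [not_lt] at hsθ
    obtain ⟨v, hv⟩ : ∃ v, κ < x.1 v := by
      by_contra! h
      have h1 := Finset.sum_le_sum fun v (_ : v ∈ Finset.univ) => h v
      rw [x.2.2.1, Finset.sum_const, Finset.card_univ, nsmul_eq_mul] at h1
      have : (Fintype.card V : ℝ) * κ < 1 := by
        simp only [κ]
        rw [mul_one_div, div_lt_one (by positivity)]
        linarith
      linarith
    have hxv := hκ.trans hv
    refine ⟨v, ?_⟩
    by_cases hvr : v = r
    · subst hvr
      rw [hzr]
      exact add_pos_of_pos_of_nonneg hxv (le_max_right _ _)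
    have hsκ : s * κ ≤ κ := mul_le_of_le_one_left hκ.le hs.2
    by_cases hx : x ∈ Set.range J
    · obtain ⟨i, hi⟩ := (hJr x).1 hx
      have hmi : 0 < m i x := (Finset.lt_inf'_iff (hne i)).2 hi
      rw [hcell_z s hs x i hi v hvr]
      refine mul_pos (add_pos_of_nonneg_of_pos (sub_nonneg.2 hs.2) hmi) (sub_pos.2 ?_)
      split_ifs
      · rw [one_mul]
        exact ((min_le_right _ _).trans hsκ).trans_lt hv
      · simpa using hxv
    · rw [hstar_z s hs x hx v hvr]
      rw [hstar_θ x hx] at hsθ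
      have hs0 : s = 0 := le_antisymm (nonpos_of_mul_nonpos_left hsθ hκ) hs.1
      simpa [hs0] using hxv
  have hzface : ∀ s ∈ unitInterval, ∀ x, ∃ ρ, K ρ ∧ ∀ v, z s x v ≠ 0 → v ∈ ρ := by
    intro s hs x
    by_cases hx : x ∈ Set.range J
    · obtain ⟨i, hi⟩ := (hJr x).1 hx
      have hmi : 0 < m i x := (Finset.lt_inf'_iff (hne i)).2 hi
      have hout : ∀ v, v ≠ r → z s x v ≠ 0 → v ∈ σ i := by
        intro v hv hz
        by_contra hvi
        rw [hcell_z s hs x i hi v hv, x.eq_zero_of_notMem (hsuppσ i x hi) hvi] at hz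
        simp [hvi] at hz
      by_cases hsθ : s * κ ≤ m i x
      · refine ⟨σ i, hσ i, fun v hv => hout v ?_ hv⟩
        rintro rfl
        rw [hzr, hcell_r x i hi, hcell_θ x i hi, max_eq_right (sub_nonpos.2 hsθ)] at hv
        simp at hv
      · obtain ⟨w, hw, hwm⟩ := Finset.exists_mem_eq_inf' (hne i) x.1
        have hwm' : m i x = x.1 w := hwm
        refine ⟨insert r ((σ i).erase w), ?_, fun v hv => ?_⟩
        · rcases hcov _ (hK _ _ (hσ i) (Finset.erase_subset w _)) with h | ⟨k, hk⟩
          · exact h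
          · have h1 := Finset.card_erase_of_mem hw
            rw [hk, hcard, hcard] at h1
            omega
        · by_cases hvr : v = r
          · simp [hvr]
          · refine Finset.mem_insert_of_mem (Finset.mem_erase.2 ⟨?_, hout v hvr hv⟩)
            rintro rfl
            rw [hcell_z s hs x i hi v hvr, min_eq_left (not_le.1 hsθ).le, if_pos hw, hwm'] at hv
            simp at hv
    · refine ⟨insert r ({v | x.1 v ≠ 0} : Finset V), ?_, fun v hv => ?_⟩
      · rcases hcov _ (x.support_mem hK) with h | ⟨k, hk⟩
        · exact h
        · refine absurd ((hJr x).2 ⟨k, fun v hv => lt_of_le_of_ne (x.2.1 v) (Ne.symm ?_)⟩) hx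
          rw [← hk] at hv
          simpa using hv
      · by_cases hvr : v = r
        · simp [hvr]
        · rw [hstar_z s hs x hx v hvr] at hv
          simpa [hvr] using right_ne_zero_of_mul hv
  have hzcont : Continuous fun q : unitInterval × Realization K => z q.1 q.2 := by
    refine continuous_pi fun v => ?_
    have h1 : ∀ v, Continuous fun q : unitInterval × Realization K => q.2.1 v := fun v =>
      (continuous_apply v).comp (continuous_subtype_val.comp continuous_snd)
    have h2 : ∀ i, Continuous fun q : unitInterval × Realization K => m i q.2 := fun i =>
      (hm i).comp continuous_snd
    have h3 : Continuous fun q : unitInterval × Realization K => θ q.2 :=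
      continuous_finsetSum _ fun i _ => h2 i
    have h4 := h1 r
    have h5 := h1 v
    by_cases hv : v = r
    · simp only [z, if_pos hv]
      fun_prop
    · simp only [z, if_neg hv]
      fun_prop
  have hzsum : ∀ s ∈ unitInterval, ∀ x, 0 < ∑ v, z s x v := fun s hs x =>
    let ⟨v, hv⟩ := hzpos s hs x
    Finset.sum_pos' (fun v _ => hznn s hs x v) ⟨v, Finset.mem_univ v, hv⟩
  let H : C(unitInterval × Realization K, Realization K) :=
    ⟨fun q => ⟨fun v => z q.1 q.2 v / ∑ w, z q.1 q.2 w,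
      fun v => div_nonneg (hznn _ q.1.2 _ v) (hzsum _ q.1.2 _).le,
      by rw [← Finset.sum_div, div_self (hzsum _ q.1.2 _).ne'],
      (hzface _ q.1.2 q.2).imp fun ρ hρ => ⟨hρ.1, fun v hv => hρ.2 v (div_ne_zero_iff.1 hv).1⟩⟩,
      Continuous.subtype_mk (continuous_pi fun v => ((continuous_apply v).comp hzcont).div
        (continuous_finsetSum _ fun w _ => (continuous_apply w).comp hzcont)
        fun q => (hzsum _ q.1.2 _).ne') _⟩
  have hHapp : ∀ t x v, (H (t, x)).1 v = z t x v / ∑ w, z t x w := fun _ _ _ => rfl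
  let a : Realization K := ⟨fun v => if v = r then 1 else 0,
    fun v => by dsimp only; split_ifs <;> norm_num, by simp, {r}, hr, fun v hv => by simpa using hv⟩
  have hnotmem : ∀ x : Realization K, (∀ i, ∃ v ∈ σ i, x.1 v = 0) → x ∉ Set.range J := by
    intro x hx hxJ
    obtain ⟨i, hi⟩ := (hJr x).1 hxJ
    obtain ⟨v, hv, hv0⟩ := hx i
    exact (hi v hv).ne' hv0
  suffices h : Nonempty
      (ContinuousMap.HomotopyEquiv (Realization K) (OnePoint (Fin N × (Fin d → ℝ)))) by
    obtain ⟨E⟩ := h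
    obtain ⟨b, ⟨e⟩⟩ := exists_onePoint_homeomorph_wedgeSpheres N d hN
    exact ⟨b, ⟨E.trans e.toHomotopyEquiv⟩⟩
  refine homotopyEquiv_onePoint J hJ H ?_ ?_ a ?_ ?_
  · intro x
    have hz : ∀ v, z 0 x v = (1 + θ x) * x.1 v := by
      intro v
      by_cases hv : v = r
      · subst hv
        rw [hzr]
        by_cases hx : x ∈ Set.range J
        · obtain ⟨i, hi⟩ := (hJr x).1 hx
          simp [hcell_r x i hi, hθ0 x]
        · simp [hstar_θ x hx]
      · rw [hzv 0 x v hv]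
        simp [hm0]
    refine Subtype.ext (funext fun v => ?_)
    have h1 : 1 + θ x ≠ 0 := by linarith [hθ0 x]
    rw [hHapp]
    simp only [Set.Icc.coe_zero, hz, ← Finset.mul_sum, x.2.2.1]
    field_simp
  · intro t x hx
    refine hnotmem _ fun i => ?_
    have : ¬ ∀ v ∈ σ i, 0 < x.1 v := fun h => hx ((hJr x).2 ⟨i, h⟩)
    push Not at this
    obtain ⟨v, hv, hv0⟩ := this
    have hvr : v ≠ r := fun h => hr' i (h ▸ hv)
    refine ⟨v, hv, ?_⟩
    rw [hHapp, hstar_z t t.2 x hx v hvr, le_antisymm hv0 (x.2.1 v)]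
    simp
  · refine hnotmem _ fun i => ?_
    obtain ⟨v, hv⟩ := hne i
    exact ⟨v, hv, if_neg fun h : v = r => hr' i (h ▸ hv)⟩
  · intro x hx
    have hz : ∀ v, v ≠ r → z 1 x v = 0 := fun v hv => by
      rw [hstar_z 1 unitInterval.one_mem x hx v hv]
      simp
    have hzs := Finset.sum_eq_single (s := Finset.univ) r (fun v _ hv => hz v hv) (by simp)
    have hpos := hzsum 1 unitInterval.one_mem x
    refine Subtype.ext (funext fun v => ?_)
    rw [hHapp]
    simp only [Set.Icc.coe_one, a]
    by_cases hv : v = r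
    · subst hv
      rw [hzs] at hpos ⊢
      rw [div_self hpos.ne', if_pos rfl]
    · rw [hz v hv, if_neg hv, zero_div]

theorem isDisconn_pair {V : Type*} [DecidableEq V] (G : SimpleGraph V) {a b : V} (hab : a ≠ b) :
    IsDisconn G {a, b} ↔ ¬ G.Adj a b := by
  have hset : (({a, b} : Finset V) : Set V) = {a, b} := by simp
  rw [IsDisconn, hset, not_iff_not]
  refine ⟨fun h => ?_, SimpleGraph.induce_pair_connected_of_adj⟩
  obtain ⟨w⟩ := h.preconnected ⟨a, by simp⟩ ⟨b, by simp⟩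
  cases w with
  | nil => exact absurd rfl hab
  | @cons _ c _ hac _ =>
    have hac' : G.Adj a c := hac
    rcases c.2 with hc | hc
    · exact absurd hc.symm hac'.ne
    · exact hc ▸ hac'

theorem isFace_two_iff {V : Type*} [Fintype V] [DecidableEq V] (G : SimpleGraph V)
    (σ : Finset V) : IsFace G 2 σ ↔ ∃ a b, a ≠ b ∧ ¬ G.Adj a b ∧ a ∉ σ ∧ b ∉ σ := by
  constructor
  · rintro ⟨S, hS, hcard, hdis⟩
    obtain ⟨a, b, hab, rfl⟩ := Finset.card_eq_two.1 hcard
    exact ⟨a, b, hab, (isDisconn_pair G hab).1 hdis,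
      Finset.mem_compl.1 (hS (Finset.mem_insert_self a {b})),
      Finset.mem_compl.1 (hS (Finset.mem_insert_of_mem (Finset.mem_singleton_self b)))⟩
  · rintro ⟨a, b, hab, hadj, ha, hb⟩
    exact ⟨{a, b}, by simp [Finset.insert_subset_iff, ha, hb], Finset.card_pair hab,
      (isDisconn_pair G hab).2 hadj⟩

theorem isFace_mono {V : Type*} [Fintype V] [DecidableEq V] (G : SimpleGraph V) (k : ℕ)
    {σ ρ : Finset V} (h : IsFace G k σ) (hρ : ρ ⊆ σ) : IsFace G k ρ :=
  h.imp fun _ hS => ⟨hS.1.trans (Finset.compl_subset_compl.2 hρ), hS.2⟩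

theorem isFace_two_of_cliqueFree {V : Type*} [Fintype V] [DecidableEq V] {G : SimpleGraph V}
    (htri : G.CliqueFree 3) {σ : Finset V} (hσ : 3 ≤ σᶜ.card) : IsFace G 2 σ := by
  obtain ⟨T, hT, hcard⟩ := Finset.exists_subset_card_eq hσ
  rw [isFace_two_iff]
  by_contra! h
  refine htri T ⟨fun a ha b hb hab => ?_, hcard⟩
  by_contra hadj
  exact Finset.mem_compl.1 (hT hb) (h a b hab hadj (Finset.mem_compl.1 (hT ha)))

theorem three_lt_card_of_cliqueFree {V : Type*} [Fintype V] {G : SimpleGraph V}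
    (htri : G.CliqueFree 3) (hG : ¬ G.IsAcyclic) : 3 < Fintype.card V := by
  classical
  simp only [SimpleGraph.IsAcyclic, not_forall, not_not] at hG
  obtain ⟨v, c, hc⟩ := hG
  have h3 := hc.three_le_length
  have hle : c.length ≤ Fintype.card V := by
    have := hc.support_nodup.length_le_card
    simpa using this
  have hne : c.length ≠ 3 := fun h => by
    obtain ⟨s, hs⟩ := SimpleGraph.is3Clique_iff_exists_cycle_length_three.2 ⟨v, c, hc, h⟩
    exact htri s hs
  omega

/-- A face of the 2-cut complex whose complement lies in `{r, u, v}`, where `u` and `v` are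
adjacent, misses `r` and a vertex not adjacent to it. -/
theorem IsFace.eq_compl_of_compl_subset {V : Type*} [Fintype V] [DecidableEq V] {G : SimpleGraph V}
    {r u v : V} (huv : G.Adj u v) {ρ : Finset V} (hρ : IsFace G 2 ρ)
    (hsub : ({r, u, v} : Finset V)ᶜ ⊆ ρ) :
    ρ = {r, u, v}ᶜ ∨ ρ = {r, u}ᶜ ∨ (¬ G.Adj r v ∧ ρ = {r, v}ᶜ) := by
  obtain ⟨a, b, hab, hnadj, ha, hb⟩ := (isFace_two_iff G ρ).1 hρ
  have hsub' : ∀ x, x ∉ ρ → x = r ∨ x = u ∨ x = v := by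
    intro x hx
    by_contra h
    exact hx (hsub (by simpa using h))
  have key : r ∉ ρ ∧ (u ∉ ρ ∨ v ∉ ρ ∧ ¬ G.Adj r v) := by
    have huv' := huv.symm
    rcases hsub' a ha with rfl | rfl | rfl <;> rcases hsub' b hb with rfl | rfl | rfl <;>
      first
      | exact absurd rfl hab
      | exact absurd huv hnadj
      | exact absurd huv' hnadj
      | skip
    · exact ⟨ha, Or.inl hb⟩
    · exact ⟨ha, Or.inr ⟨hb, hnadj⟩⟩
    · exact ⟨hb, Or.inl ha⟩
    · exact ⟨hb, Or.inr ⟨ha, fun h => hnadj h.symm⟩⟩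
  obtain ⟨hr, hor⟩ := key
  have heq : ∀ T : Finset V, (∀ x, x ∈ T ↔ x ∉ ρ) → ρ = Tᶜ := fun T hT => by
    ext x
    simp [hT]
  by_cases hu : u ∈ ρ <;> by_cases hv : v ∈ ρ
  · simp [hu, hv] at hor
  · refine Or.inr (Or.inr ⟨by simpa [hu, hv] using hor, heq _ fun x => ?_⟩)
    have := hsub' x
    simp only [Finset.mem_insert, Finset.mem_singleton]
    grind
  · refine Or.inr (Or.inl (heq _ fun x => ?_))
    have := hsub' x
    simp only [Finset.mem_insert, Finset.mem_singleton]
    grind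
  · refine Or.inl (heq _ fun x => ?_)
    have := hsub' x
    simp only [Finset.mem_insert, Finset.mem_singleton]
    grind

/-- The faces of the 2-cut complex that remain after removing, for each `w ∈ S`, the facet
`{r, w}ᶜ` together with its face `{r, w, p w}ᶜ`. -/
def IsResidualFace {V : Type*} [Fintype V] [DecidableEq V] (G : SimpleGraph V) (r : V) (p : V → V)
    (S : Finset V) (ρ : Finset V) : Prop :=
  IsFace G 2 ρ ∧ ∀ w ∈ S, ρ ≠ {r, w, p w}ᶜ ∧ ρ ≠ {r, w}ᶜ

theorem IsResidualFace.mono {V : Type*} [Fintype V] [DecidableEq V] {G : SimpleGraph V} {r : V}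
    {p : V → V} {S : Finset V} (hadj : ∀ w ∈ S, G.Adj w (p w))
    (hS : ∀ w ∈ S, ¬ G.Adj r (p w) → p w ∈ S) {σ ρ : Finset V} (hσ : IsResidualFace G r p S σ)
    (hρ : ρ ⊆ σ) : IsResidualFace G r p S ρ := by
  have key : ∀ w ∈ S, ¬ ({r, w, p w} : Finset V)ᶜ ⊆ σ := by
    intro w hw hsub
    rcases hσ.1.eq_compl_of_compl_subset (hadj w hw) hsub with h | h | ⟨h', h⟩
    · exact (hσ.2 w hw).1 h
    · exact (hσ.2 w hw).2 h
    · exact (hσ.2 _ (hS w hw h')).2 h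
  refine ⟨isFace_mono G 2 hσ.1 hρ, fun w hw => ⟨?_, ?_⟩⟩
  · rintro rfl
    exact key w hw hρ
  · rintro rfl
    refine key w hw ((Finset.compl_subset_compl.2 fun x hx => ?_).trans hρ)
    simp only [Finset.mem_insert, Finset.mem_singleton] at hx ⊢
    tauto

/-- The 2-cut complex collapses onto its residual faces when `p w` is, for each `w ∈ S`, a
neighbour of `w` closer to `r`. -/
theorem homotopyEquiv_isResidualFace {V : Type*} [Fintype V] [DecidableEq V]
    (G : SimpleGraph V) (hV : 3 < Fintype.card V) (r : V) (p : V → V) (l : V → ℕ) (k : ℕ) :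
    ∀ S : Finset V, (∀ w ∈ S, w ≠ r ∧ ¬ G.Adj r w) →
      (∀ w ∈ S, G.Adj w (p w) ∧ l (p w) < l w) →
      (∀ w ∈ S, ¬ G.Adj r (p w) → p w ∈ S) → S.card = k →
      Nonempty (ContinuousMap.HomotopyEquiv (Realization (IsFace G 2))
        (Realization (IsResidualFace G r p S))) := by
  induction k with
  | zero =>
    intro S _ _ _ hS
    obtain rfl := Finset.card_eq_zero.1 hS
    have : IsResidualFace G r p ∅ = IsFace G 2 := by
      funext ρ
      simp [IsResidualFace]
    rw [this]
    exact ⟨ContinuousMap.HomotopyEquiv.refl _⟩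
  | succ k ih =>
    intro S hSN hSp hSclosed hS
    obtain ⟨w, hw, hwmax⟩ := Finset.exists_max_image S l (Finset.card_pos.1 (by omega))
    obtain ⟨hwr, hrw⟩ := hSN w hw
    obtain ⟨hadj, hlt⟩ := hSp w hw
    have hne : ∀ u ∈ S, p u ≠ r := fun u hu h => (hSN u hu).2 (h ▸ (hSp u hu).1.symm)
    have hpr := hne w hw
    have hclosed : ∀ u ∈ S.erase w, ¬ G.Adj r (p u) → p u ∈ S.erase w := by
      intro u hu hur
      have huS := Finset.mem_of_mem_erase hu
      refine Finset.mem_erase.2 ⟨fun h => ?_, hSclosed u huS hur⟩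
      exact absurd (h ▸ (hSp u huS).2) (not_lt.2 (hwmax u huS))
    have herase : ∀ u ∈ S.erase w, u ∈ S := fun u => Finset.mem_of_mem_erase
    obtain ⟨E⟩ := ih (S.erase w) (fun u hu => hSN u (herase u hu))
      (fun u hu => hSp u (herase u hu)) hclosed (by rw [Finset.card_erase_of_mem hw, hS]; rfl)
    have hins : insert (p w) ({r, w, p w} : Finset V)ᶜ = {r, w}ᶜ := by
      ext v
      by_cases hv : v = p w
      · subst hv
        simp [hpr, hadj.ne']
      · simp [hv]
    have htriple : ∀ u ∈ S, ({r, u, p u} : Finset V).card = 3 := fun u hu =>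
      Finset.card_eq_three.2
        ⟨r, u, p u, (hSN u hu).1.symm, (hne u hu).symm, (hSp u hu).1.ne, rfl⟩
    have hface : IsResidualFace G r p (S.erase w) {r, w}ᶜ := by
      refine ⟨(isFace_two_iff G _).2 ⟨r, w, hwr.symm, hrw, by simp, by simp⟩,
        fun u hu => ⟨fun h => ?_, fun h => ?_⟩⟩
      · have h1 := htriple u (herase u hu)
        rw [← compl_injective h, Finset.card_pair hwr.symm] at h1
        omega
      · have h1 : w ∈ ({r, u} : Finset V) := compl_injective h ▸ by simp
        simp only [Finset.mem_insert, Finset.mem_singleton] at h1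
        exact (Finset.mem_erase.1 hu).1 (h1.resolve_left hwr).symm
    obtain ⟨F⟩ := homotopyEquiv_collapse (IsResidualFace G r p (S.erase w))
      (fun σ ρ hσ => hσ.mono (fun u hu => (hSp u (herase u hu)).1) hclosed) {r, w, p w}ᶜ
      (Finset.card_pos.1 (by rw [Finset.card_compl, htriple w hw]; omega)) (p w) (by simp)
      (hins ▸ hface) (by
        intro ρ hρ hsub
        rw [hins]
        rcases hρ.1.eq_compl_of_compl_subset hadj hsub with h | h | ⟨h', h⟩
        · exact Or.inl h
        · exact Or.inr h
        · exact absurd h (hρ.2 _ (Finset.mem_erase.2 ⟨hadj.ne', hSclosed w hw h'⟩)).2)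
    have heq : (fun ρ => IsResidualFace G r p (S.erase w) ρ ∧ ρ ≠ {r, w, p w}ᶜ ∧
        ρ ≠ insert (p w) {r, w, p w}ᶜ) = IsResidualFace G r p S := by
      funext ρ
      rw [hins, IsResidualFace, IsResidualFace, and_assoc]
      refine propext (and_congr_right fun _ => ⟨fun h u hu => ?_, fun h =>
        ⟨fun u hu => h u (herase u hu), h w hw⟩⟩)
      by_cases huw : u = w
      · exact huw ▸ h.2
      · exact h.1 u (Finset.mem_erase.2 ⟨huw, hu⟩)
    rw [heq] at F
    exact ⟨E.trans F⟩

theorem SimpleGraph.Connected.exists_adj_dist_lt {V : Type*} {G : SimpleGraph V}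
    (hconn : G.Connected) {r w : V} (hw : w ≠ r) : ∃ u, G.Adj w u ∧ G.dist u r < G.dist w r := by
  obtain ⟨q, hq⟩ := hconn.exists_walk_length_eq_dist w r
  cases q with
  | nil => exact absurd rfl hw
  | @cons _ u _ h q =>
    refine ⟨u, h, ?_⟩
    have := SimpleGraph.dist_le q
    rw [SimpleGraph.Walk.length_cons] at hq
    omega

theorem SimpleGraph.Connected.card_le_card_edgeFinset {V : Type*} [Fintype V] {G : SimpleGraph V}
    [DecidableRel G.Adj] (hconn : G.Connected) (hG : ¬ G.IsAcyclic) :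
    Fintype.card V ≤ G.edgeFinset.card := by
  classical
  have h1 := hconn.card_vert_le_card_edgeSet_add_one
  have h2 : ¬ (Nat.card G.edgeSet + 1 = Nat.card V) := fun h =>
    hG (SimpleGraph.isTree_iff_connected_and_card.2 ⟨hconn, h⟩).isAcyclic
  rw [Nat.card_eq_fintype_card, Nat.card_eq_fintype_card, ← SimpleGraph.edgeFinset_card] at h1 h2
  omega

/-- Discarding the edges at `r` and the edges from the vertices not adjacent to `r` to their
parents leaves `e - n + 1` edges. -/
theorem SimpleGraph.card_edgeFinset_sdiff_parent_edges {V : Type*} [Fintype V] [DecidableEq V]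
    (G : SimpleGraph V) [DecidableRel G.Adj] (r : V) (p : V → V) (l : V → ℕ) (N : Finset V)
    (hN : ∀ w, w ∈ N ↔ w ≠ r ∧ ¬ G.Adj r w)
    (hp : ∀ w ∈ N, G.Adj w (p w) ∧ l (p w) < l w) :
    ((G.edgeFinset \ G.incidenceFinset r) \ N.image fun w => s(w, p w)).card + Fintype.card V =
      G.edgeFinset.card + 1 := by
  have hinj : Set.InjOn (fun w => s(w, p w)) N := by
    intro u hu w hw h
    rcases Sym2.eq_iff.1 h with h | ⟨h1, h2⟩
    · exact h.1
    · have hlu := (hp u hu).2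
      have hlw := (hp w hw).2
      rw [h2] at hlu
      rw [← h1] at hlw
      exact absurd hlu hlw.asymm
  have hsub : (N.image fun w => s(w, p w)) ⊆ G.edgeFinset \ G.incidenceFinset r := by
    intro c hc
    obtain ⟨w, hw, rfl⟩ := Finset.mem_image.1 hc
    have hadj := (hp w hw).1
    obtain ⟨hwr, hrw⟩ := (hN w).1 hw
    refine Finset.mem_sdiff.2 ⟨SimpleGraph.mem_edgeFinset.2 hadj, fun h => ?_⟩
    rw [SimpleGraph.mem_incidenceFinset] at h
    rcases Sym2.mem_iff.1 h.2 with h | h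
    · exact hwr h.symm
    · exact hrw (h ▸ hadj.symm)
  have h1 := Finset.card_sdiff_add_card_eq_card hsub
  have h2 := Finset.card_sdiff_add_card_eq_card (G.incidenceFinset_subset r)
  rw [Finset.card_image_of_injOn hinj] at h1
  rw [SimpleGraph.card_incidenceFinset_eq_degree] at h2
  have h3 : N = (insert r (G.neighborFinset r))ᶜ := by
    ext w
    simp [hN]
  have h4 := Finset.card_compl_add_card (insert r (G.neighborFinset r))
  rw [← h3, Finset.card_insert_of_notMem (by simp), SimpleGraph.card_neighborFinset_eq_degree] at h4
  omega

/-- If `G` is a connected triangle-free graph on `n` vertices with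
`e` edges that is not a tree (i.e. is not acyclic), then `Δ_2(G)` is homotopy
equivalent to a wedge of `e - n + 1` spheres of dimension `n - 4`. -/
theorem stmt_19 {V : Type*} [Fintype V] [DecidableEq V] (G : SimpleGraph V)
    [DecidableRel G.Adj] (n e : ℕ) (hn : Fintype.card V = n)
    (he : G.edgeFinset.card = e) (hconn : G.Connected)
    (htri : G.CliqueFree 3) (hnottree : ¬ G.IsAcyclic) :
    ∃ b : Sphere (n - 4),
      Nonempty
        (ContinuousMap.HomotopyEquiv (Realization (IsFace G 2))
          (WedgeSpheres (e - n + 1) (n - 4) b)) := by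
  have hV := three_lt_card_of_cliqueFree htri hnottree
  have hne := hconn.card_le_card_edgeFinset hnottree
  obtain ⟨r⟩ := hconn.nonempty
  have hex : ∀ w, ∃ u, w ≠ r → G.Adj w u ∧ G.dist u r < G.dist w r := fun w => by
    by_cases hw : w = r
    · exact ⟨r, fun h => absurd hw h⟩
    · exact (hconn.exists_adj_dist_lt hw).imp fun _ h _ => h
  choose p hp using hex
  set N : Finset V := {w | w ≠ r ∧ ¬ G.Adj r w} with hNdef
  have hN : ∀ w, w ∈ N ↔ w ≠ r ∧ ¬ G.Adj r w := fun w => by simp [hNdef]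
  have hpN : ∀ w ∈ N, G.Adj w (p w) ∧ G.dist (p w) r < G.dist w r := fun w hw =>
    hp w ((hN w).1 hw).1
  have hpr : ∀ w ∈ N, p w ≠ r := fun w hw h => ((hN w).1 hw).2 (h ▸ (hpN w hw).1.symm)
  have hclosed : ∀ w ∈ N, ¬ G.Adj r (p w) → p w ∈ N := fun w hw h => (hN _).2 ⟨hpr w hw, h⟩
  set C := (G.edgeFinset \ G.incidenceFinset r) \ N.image fun w => s(w, p w) with hC
  have hCcard : C.card = e - n + 1 := by
    have : C.card + _ = _ := G.card_edgeFinset_sdiff_parent_edges r p (G.dist · r) N hN hpN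
    omega
  have hCmem : ∀ a b, s(a, b) ∈ C ↔
      (G.Adj a b ∧ r ≠ a ∧ r ≠ b) ∧ ∀ w ∈ N, s(w, p w) ≠ s(a, b) := by
    intro a b
    simp only [hC, Finset.mem_sdiff, SimpleGraph.mem_edgeFinset, SimpleGraph.mem_incidenceFinset,
      SimpleGraph.mem_edgeSet, SimpleGraph.incidenceSet, Set.mem_sep_iff, Sym2.mem_iff,
      Finset.mem_image, not_exists, not_and, not_or]
    exact ⟨fun h => ⟨⟨h.1.1, h.1.2 h.1.1⟩, h.2⟩, fun h => ⟨⟨h.1.1, fun _ => h.1.2⟩, h.2⟩⟩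
  obtain ⟨E⟩ := homotopyEquiv_isResidualFace G hV r p (G.dist · r) N.card N
    (fun w => (hN w).1) hpN hclosed rfl
  have hmono : ∀ σ ρ, IsResidualFace G r p N σ → ρ ⊆ σ → IsResidualFace G r p N ρ :=
    fun σ ρ hσ => hσ.mono (fun w hw => (hpN w hw).1) hclosed
  have hresidual : ∀ ρ, r ∈ ρ → IsFace G 2 ρ → IsResidualFace G r p N ρ := by
    refine fun ρ hr hρ => ⟨hρ, fun w hw => ⟨?_, ?_⟩⟩ <;>
    · rintro rfl
      simp at hr
  let φ : C ≃ Fin (e - n + 1) := C.equivFinOfCardEq hCcard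
  let σ : Fin (e - n + 1) → Finset V := fun i => (insert r (φ.symm i).1.toFinset)ᶜ
  have hσ : ∀ i, ∃ a b, s(a, b) ∈ C ∧ (φ.symm i).1 = s(a, b) ∧ σ i = {r, a, b}ᶜ := by
    intro i
    obtain ⟨c, hc⟩ : ∃ c, c = φ.symm i := ⟨_, rfl⟩
    obtain ⟨c, hcC⟩ := c
    induction c with
    | h a b => exact ⟨a, b, hcC, by rw [← hc], by simp [σ, ← hc, Sym2.toFinset_mk_eq]⟩
  have htriple : ∀ a b, s(a, b) ∈ C → ({r, a, b} : Finset V).card = 3 := fun a b h =>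
    have h' := ((hCmem a b).1 h).1
    Finset.card_eq_three.2 ⟨r, a, b, h'.2.1, h'.2.2, h'.1.ne, rfl⟩
  have hpair : ∀ {a b c d : V}, r ≠ a → r ≠ b → r ≠ c → r ≠ d →
      ({r, a, b} : Finset V) = {r, c, d} → a ≠ b → s(a, b) = s(c, d) := by
    intro a b c d ha hb hc hd h hab
    have h1 : a ∈ ({r, c, d} : Finset V) := h ▸ by simp
    have h2 : b ∈ ({r, c, d} : Finset V) := h ▸ by simp
    simp only [Finset.mem_insert, Finset.mem_singleton] at h1 h2
    rw [Sym2.eq_iff]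
    grind
  suffices h : ∃ b : Sphere (n - 4), Nonempty (ContinuousMap.HomotopyEquiv
      (Realization (IsResidualFace G r p N)) (WedgeSpheres (e - n + 1) (n - 4) b)) by
    obtain ⟨b, ⟨F⟩⟩ := h
    exact ⟨b, ⟨E.trans F⟩⟩
  refine homotopyEquiv_wedgeSpheres (IsResidualFace G r p N) hmono r
    (hresidual _ (Finset.mem_singleton_self r) (isFace_two_of_cliqueFree htri (by
      rw [Finset.card_compl, Finset.card_singleton]; omega)))
    (e - n + 1) (n - 4) (Nat.succ_pos _) σ ?_ ?_ ?_ ?_ ?_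
  · intro i j hij
    obtain ⟨a, b, hab, hi, hσi⟩ := hσ i
    obtain ⟨c, d, hcd, hj, hσj⟩ := hσ j
    rw [hσi, hσj] at hij
    have h1 := ((hCmem a b).1 hab).1
    have h2 := ((hCmem c d).1 hcd).1
    refine φ.symm.injective (Subtype.ext ?_)
    rw [hi, hj]
    exact hpair h1.2.1 h1.2.2 h2.2.1 h2.2.2 (compl_injective hij) h1.1.ne
  · intro i
    obtain ⟨a, b, hab, -, hσi⟩ := hσ i
    rw [hσi, Finset.card_compl, htriple a b hab]
    omega
  · intro i
    obtain ⟨a, b, hab, -, hσi⟩ := hσ i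
    rw [hσi]
    have h1 := (hCmem a b).1 hab
    refine ⟨isFace_two_of_cliqueFree htri (by rw [compl_compl, htriple a b hab]),
      fun w hw => ⟨fun h => ?_, fun h => ?_⟩⟩
    · exact h1.2 w hw (hpair h1.1.2.1 h1.1.2.2 ((hN w).1 hw).1.symm (hpr w hw).symm
        (compl_injective h) h1.1.1.ne).symm
    · have h2 := htriple a b hab
      rw [compl_injective h, Finset.card_pair ((hN w).1 hw).1.symm] at h2
      omega
  · intro i hi
    obtain ⟨a, b, hab, -, hσi⟩ := hσ i
    obtain ⟨x, y, hxy, hnadj, hx, hy⟩ := (isFace_two_iff G _).1 hi.1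
    rw [hσi] at hx hy
    have hadj := ((hCmem a b).1 hab).1.1
    have hadj' := hadj.symm
    simp only [Finset.mem_insert, Finset.mem_compl, Finset.mem_singleton] at hx hy
    grind
  · intro τ hτ
    by_cases hrτ : IsFace G 2 (insert r τ)
    · exact Or.inl (hresidual _ (Finset.mem_insert_self r τ) hrτ)
    obtain ⟨x, y, hxy, hnadj, hx, hy⟩ := (isFace_two_iff G _).1 hτ.1
    have hclique : ∀ a b, a ≠ r → b ≠ r → a ∉ τ → b ∉ τ → a ≠ b → G.Adj a b := by
      intro a b har hbr ha hb hab
      by_contra h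
      exact hrτ ((isFace_two_iff G _).2 ⟨a, b, hab, h, by simp [har, ha], by simp [hbr, hb]⟩)
    obtain ⟨w, hwτ, hwr, hrw, hr⟩ : ∃ w, w ∉ τ ∧ w ≠ r ∧ ¬ G.Adj r w ∧ r ∉ τ := by
      by_cases hxr : x = r
      · subst hxr
        exact ⟨y, hy, hxy.symm, hnadj, hx⟩
      by_cases hyr : y = r
      · subst hyr
        exact ⟨x, hx, hxy, fun h => hnadj h.symm, hy⟩
      · exact absurd (hclique x y hxr hyr hx hy hxy) hnadj
    have hwN := (hN w).2 ⟨hwr, hrw⟩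
    obtain ⟨u, huτ, hur, huw⟩ : ∃ u, u ∉ τ ∧ u ≠ r ∧ u ≠ w := by
      by_contra! h
      refine (hτ.2 w hwN).2 ?_
      ext v
      simp only [Finset.mem_compl, Finset.mem_insert, Finset.mem_singleton]
      grind
    have huw' := hclique u w hur hwr huτ hwτ huw
    have hτeq : τ = {r, u, w}ᶜ := by
      ext v
      simp only [Finset.mem_compl, Finset.mem_insert, Finset.mem_singleton, not_or]
      refine ⟨fun hv => ⟨?_, ?_, ?_⟩, fun hv => ?_⟩
      · rintro rfl; exact hr hv
      · rintro rfl; exact huτ hv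
      · rintro rfl; exact hwτ hv
      · by_contra hvτ
        exact htri {v, u, w} (SimpleGraph.is3Clique_triple_iff.2
          ⟨hclique v u hv.1 hur hvτ huτ hv.2.1, hclique v w hv.1 hwr hvτ hwτ hv.2.2, huw'⟩)
    have huwC : s(u, w) ∈ C := by
      refine (hCmem u w).2 ⟨⟨huw', hur.symm, hwr.symm⟩, fun v hv h => (hτ.2 v hv).1 ?_⟩
      rw [hτeq]
      rcases Sym2.eq_iff.1 h with ⟨h1, h2⟩ | ⟨h1, h2⟩
      · rw [h1, ← h2, h1]
      · rw [h2, h1, Finset.pair_comm]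
    refine Or.inr ⟨φ ⟨s(u, w), huwC⟩, ?_⟩
    simp [σ, hτeq, Sym2.toFinset_mk_eq]
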